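/- Fix a natural number M and set N = 2M. Let Q ∈ ℂ[X] be the polynomial whose value at u is Σ_{k=0}^{M} (−M)_k · (1/2 + i·u)_k · (1/2 − i·u)_k / (k!)³. Then neither i/2 nor −i/2 is a root of Q, and the sum over the roots u of Q in ℂ (counted with multiplicity) of 2/(u² + 1/4) equals 4·(S₁(N) + S_{−1}(N)). -/

import Mathlib

/-- Nested (signed) harmonic sum `S_{a₁,…,a_ℓ}(N)`,
`S_{a₁,…,a_ℓ}(N) = Σ_{n=1}^{N} (sign a₁)^n / n^{|a₁|} · S_{a₂,…,a_ℓ}(n)`, with `S_{}(n) = 1`. -/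
noncomputable def nestedS : List ℤ → ℕ → ℝ
  | [], _ => 1
  | a :: b, N => ∑ n ∈ Finset.Icc 1 N, ((Int.sign a : ℝ)) ^ n / (n : ℝ) ^ a.natAbs * nestedS b n

/-- Twist-2 Baxter polynomial as an element of `ℂ[X]`:
its value at `u` is `Σ_{k=0}^{M} (−M)_k (1/2+i·u)_k (1/2−i·u)_k / (k!)³`. -/
noncomputable def baxterQ2Poly (M : ℕ) : Polynomial ℂ :=
  ∑ k ∈ Finset.range (M + 1),
    Polynomial.C ((ascPochhammer ℂ k).eval (-(M : ℂ)) / ((k.factorial : ℂ)) ^ 3) *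
      ((ascPochhammer ℂ k).comp (Polynomial.C (1 / 2) + Polynomial.C Complex.I * Polynomial.X) *
        (ascPochhammer ℂ k).comp (Polynomial.C (1 / 2) - Polynomial.C Complex.I * Polynomial.X))

lemma derivative_ascPochhammer_succ_eval_zero (k : ℕ) :
    (ascPochhammer ℂ (k + 1)).derivative.eval 0 = (k.factorial : ℂ) := by
  rw [ascPochhammer_succ_left]
  simp [Polynomial.derivative_mul, ascPochhammer_eval_one]

lemma ascPochhammer_eval_neg_natCast (M k : ℕ) :
    (ascPochhammer ℂ k).eval (-(M : ℂ)) = (-1) ^ k * (M.choose k : ℂ) * (k.factorial : ℂ) := by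
  rw [ascPochhammer_eval_neg_eq_descPochhammer, descPochhammer_eval_eq_descFactorial,
    Nat.descFactorial_eq_factorial_mul_choose]
  push_cast
  ring

/-- The alternating binomial sum `∑ (-1)^k C(M,k)/k = -H_M`. -/
lemma sum_neg_one_pow_mul_choose_div (M : ℕ) :
    ∑ k ∈ Finset.range M, (-1 : ℂ) ^ (k + 1) * (M.choose (k + 1) : ℂ) / ((k : ℂ) + 1)
      = -∑ k ∈ Finset.range M, 1 / ((k : ℂ) + 1) := by
  induction M with
  | zero => simp
  | succ M ih =>
    have h1 : ∑ k ∈ Finset.range (M + 1),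
        (-1 : ℂ) ^ (k + 1) * (M.choose (k + 1) : ℂ) / ((k : ℂ) + 1)
        = -∑ k ∈ Finset.range M, 1 / ((k : ℂ) + 1) := by
      rw [Finset.sum_range_succ, ih]
      simp
    have h2 : ∑ k ∈ Finset.range (M + 1),
        (-1 : ℂ) ^ (k + 1) * (M.choose k : ℂ) / ((k : ℂ) + 1) = -(1 / ((M : ℂ) + 1)) := by
      have hM : (M : ℂ) + 1 ≠ 0 := by exact_mod_cast M.succ_ne_zero
      have h3 : ∀ k ∈ Finset.range (M + 1),
          (-1 : ℂ) ^ (k + 1) * (M.choose k : ℂ) / ((k : ℂ) + 1)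
          = (-1 : ℂ) ^ (k + 1) * ((M + 1).choose (k + 1) : ℂ) / ((M : ℂ) + 1) := by
        intro k _
        have hk : (k : ℂ) + 1 ≠ 0 := by exact_mod_cast k.succ_ne_zero
        have h : ((M : ℂ) + 1) * (M.choose k : ℂ)
            = ((M + 1).choose (k + 1) : ℂ) * ((k : ℂ) + 1) := by
          exact_mod_cast Nat.add_one_mul_choose_eq M k
        rw [div_eq_div_iff hk hM]
        linear_combination (-1 : ℂ) ^ (k + 1) * h
      rw [Finset.sum_congr rfl h3, ← Finset.sum_div]
      have h4 : ∑ m ∈ Finset.range (M + 1 + 1), (-1 : ℂ) ^ m * ((M + 1).choose m : ℂ) = 0 := by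
        exact_mod_cast Int.alternating_sum_range_choose_of_ne M.succ_ne_zero
      rw [Finset.sum_range_succ'] at h4
      simp only [pow_zero, Nat.choose_zero_right, Nat.cast_one, mul_one] at h4
      rw [eq_neg_of_add_eq_zero_left h4, neg_div]
    rw [Finset.sum_range_succ (fun k : ℕ => 1 / ((k : ℂ) + 1)), neg_add, ← h1, ← h2,
      ← Finset.sum_add_distrib]
    refine Finset.sum_congr rfl fun k _ => ?_
    rw [Nat.choose_succ_succ]
    push_cast
    ring

lemma nestedS_one_add_nestedS_neg_one (M : ℕ) :
    nestedS [1] (2 * M) + nestedS [-1] (2 * M) = ∑ k ∈ Finset.range M, 1 / ((k : ℝ) + 1) := by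
  induction M with
  | zero => simp [nestedS]
  | succ M ih =>
    rw [Finset.sum_range_succ, ← ih]
    simp only [nestedS, mul_add, mul_one, Finset.sum_Icc_succ_top (Nat.le_add_left 1 _)]
    have hM : (M : ℝ) + 1 ≠ 0 := by positivity
    have hM' : 2 * (M : ℝ) + 1 ≠ 0 := by positivity
    have hM'' : 2 * (M : ℝ) + 1 + 1 ≠ 0 := by positivity
    simp [pow_succ, pow_mul]
    field_simp
    ring

lemma half_add_I_mul_half : (1 / 2 : ℂ) + Complex.I * (Complex.I / 2) = 0 := by
  linear_combination (1 / 2 : ℂ) * Complex.I_mul_I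

lemma half_sub_I_mul_half : (1 / 2 : ℂ) - Complex.I * (Complex.I / 2) = 1 := by
  linear_combination (-1 / 2 : ℂ) * Complex.I_mul_I

lemma half_add_I_mul_neg_half : (1 / 2 : ℂ) + Complex.I * (-(Complex.I / 2)) = 1 := by
  linear_combination (-1 / 2 : ℂ) * Complex.I_mul_I

lemma half_sub_I_mul_neg_half : (1 / 2 : ℂ) - Complex.I * (-(Complex.I / 2)) = 0 := by
  linear_combination (1 / 2 : ℂ) * Complex.I_mul_I

lemma baxterQ2Poly_eval_half_I (M : ℕ) : (baxterQ2Poly M).eval (Complex.I / 2) = 1 := by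
  simp only [baxterQ2Poly, Polynomial.eval_finsetSum, Polynomial.eval_mul, Polynomial.eval_C,
    Polynomial.eval_comp, Polynomial.eval_add, Polynomial.eval_sub, Polynomial.eval_X,
    half_add_I_mul_half, half_sub_I_mul_half]
  rw [Finset.sum_range_succ']
  simp

lemma baxterQ2Poly_eval_neg_half_I (M : ℕ) :
    (baxterQ2Poly M).eval (-(Complex.I / 2)) = 1 := by
  simp only [baxterQ2Poly, Polynomial.eval_finsetSum, Polynomial.eval_mul, Polynomial.eval_C,
    Polynomial.eval_comp, Polynomial.eval_add, Polynomial.eval_sub, Polynomial.eval_X,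
    half_add_I_mul_neg_half, half_sub_I_mul_neg_half]
  rw [Finset.sum_range_succ']
  simp

lemma derivative_baxterQ2Poly_eval_half_I (M : ℕ) :
    (baxterQ2Poly M).derivative.eval (Complex.I / 2)
      = -Complex.I * ∑ k ∈ Finset.range M, 1 / ((k : ℂ) + 1) := by
  simp only [baxterQ2Poly, Polynomial.derivative_sum, Polynomial.derivative_mul,
    Polynomial.derivative_C, Polynomial.derivative_comp, Polynomial.derivative_add,
    Polynomial.derivative_sub, Polynomial.derivative_X,
    Polynomial.eval_finsetSum, Polynomial.eval_mul, Polynomial.eval_C, Polynomial.eval_zero,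
    Polynomial.eval_one,
    Polynomial.eval_comp, Polynomial.eval_add, Polynomial.eval_sub, Polynomial.eval_X,
    half_add_I_mul_half, half_sub_I_mul_half]
  rw [Finset.sum_range_succ', neg_mul_comm, ← sum_neg_one_pow_mul_choose_div, Finset.mul_sum]
  simp only [derivative_ascPochhammer_succ_eval_zero, ascPochhammer_eval_one,
    ascPochhammer_eval_neg_natCast, ascPochhammer_eval_zero]
  simp only [ascPochhammer_zero, Polynomial.derivative_one, Polynomial.eval_zero]
  simp only [Nat.succ_ne_zero, if_false, mul_zero, zero_mul, add_zero, zero_add, mul_one]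
  refine Finset.sum_congr rfl fun k _ => ?_
  have hk : (k : ℂ) + 1 ≠ 0 := by exact_mod_cast k.succ_ne_zero
  have hf : (k.factorial : ℂ) ≠ 0 := by exact_mod_cast k.factorial_ne_zero
  rw [Nat.factorial_succ]
  push_cast
  field_simp

lemma derivative_baxterQ2Poly_eval_neg_half_I (M : ℕ) :
    (baxterQ2Poly M).derivative.eval (-(Complex.I / 2))
      = Complex.I * ∑ k ∈ Finset.range M, 1 / ((k : ℂ) + 1) := by
  rw [← neg_neg (∑ k ∈ Finset.range M, 1 / ((k : ℂ) + 1)), ← sum_neg_one_pow_mul_choose_div]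
  simp only [baxterQ2Poly, Polynomial.derivative_sum, Polynomial.derivative_mul,
    Polynomial.derivative_C, Polynomial.derivative_comp, Polynomial.derivative_add,
    Polynomial.derivative_sub, Polynomial.derivative_X,
    Polynomial.eval_finsetSum, Polynomial.eval_mul, Polynomial.eval_C, Polynomial.eval_zero,
    Polynomial.eval_one,
    Polynomial.eval_comp, Polynomial.eval_add, Polynomial.eval_sub, Polynomial.eval_X,
    half_add_I_mul_neg_half, half_sub_I_mul_neg_half]
  rw [Finset.sum_range_succ', ← Finset.sum_neg_distrib, Finset.mul_sum]
  simp only [derivative_ascPochhammer_succ_eval_zero, ascPochhammer_eval_one,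
    ascPochhammer_eval_neg_natCast, ascPochhammer_eval_zero]
  simp only [ascPochhammer_zero, Polynomial.derivative_one, Polynomial.eval_zero]
  simp only [Nat.succ_ne_zero, if_false, mul_zero, zero_mul, add_zero, zero_add, mul_one, zero_sub]
  refine Finset.sum_congr rfl fun k _ => ?_
  have hk : (k : ℂ) + 1 ≠ 0 := by exact_mod_cast k.succ_ne_zero
  have hf : (k.factorial : ℂ) ≠ 0 := by exact_mod_cast k.factorial_ne_zero
  rw [Nat.factorial_succ]
  push_cast
  field_simp

/-- Two-loop twist-2 anomalous dimension with `N = 2M`: `±i/2` are not roots of the Baxter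
polynomial and `Σ_k 2/(u_k² + 1/4) = 4·(S₁(N) + S_{−1}(N))` over its roots (with multiplicity). -/
theorem twist2_two_loop_anomalous_dimension (M : ℕ) :
    ¬ (baxterQ2Poly M).IsRoot (Complex.I / 2) ∧
    ¬ (baxterQ2Poly M).IsRoot (-(Complex.I / 2)) ∧
    ((baxterQ2Poly M).roots.map (fun u => 2 / (u ^ 2 + 1 / 4))).sum
      = ((4 * (nestedS [1] (2 * M) + nestedS [-1] (2 * M)) : ℝ) : ℂ) := by
  have e1 := baxterQ2Poly_eval_half_I M
  have e2 := baxterQ2Poly_eval_neg_half_I M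
  have r1 : ¬ (baxterQ2Poly M).IsRoot (Complex.I / 2) := by simp [Polynomial.IsRoot, e1]
  have r2 : ¬ (baxterQ2Poly M).IsRoot (-(Complex.I / 2)) := by simp [Polynomial.IsRoot, e2]
  refine ⟨r1, r2, ?_⟩
  have s := IsAlgClosed.splits (baxterQ2Poly M)
  have d1 := s.eval_derivative_div_eval_of_ne_zero (x := Complex.I / 2) (by simp [e1])
  have d2 := s.eval_derivative_div_eval_of_ne_zero (x := -(Complex.I / 2)) (by simp [e2])
  rw [e1, div_one, derivative_baxterQ2Poly_eval_half_I] at d1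
  rw [e2, div_one, derivative_baxterQ2Poly_eval_neg_half_I] at d2
  have key : (baxterQ2Poly M).roots.map (fun u => 2 / (u ^ 2 + 1 / 4))
      = (baxterQ2Poly M).roots.map (fun u => 2 * Complex.I * (1 / (Complex.I / 2 - u))
        + -(2 * Complex.I) * (1 / (-(Complex.I / 2) - u))) := by
    refine Multiset.map_congr rfl fun u hu => ?_
    have hu' := Polynomial.isRoot_of_mem_roots hu
    have h1 : Complex.I / 2 - u ≠ 0 := fun h => r1 (by rwa [sub_eq_zero.mp h])
    have h2 : -(Complex.I / 2) - u ≠ 0 := fun h => r2 (by rwa [sub_eq_zero.mp h])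
    have h3 : u ^ 2 + 1 / 4 = (Complex.I / 2 - u) * (-(Complex.I / 2) - u) := by
      linear_combination (1 / 4 : ℂ) * Complex.I_mul_I
    rw [h3]
    generalize hx : Complex.I / 2 - u = x at *
    generalize hy : -(Complex.I / 2) - u = y at *
    field_simp
    subst hx hy
    linear_combination Complex.I_mul_I
  rw [key, Multiset.sum_map_add, Multiset.sum_map_mul_left, Multiset.sum_map_mul_left, ← d1, ← d2,
    nestedS_one_add_nestedS_neg_one]
  push_cast
  linear_combination (-4 * ∑ k ∈ Finset.range M, 1 / ((k : ℂ) + 1)) * Complex.I_mul_I
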